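/- Let S be a partial semigroup and suppose L is a minimal left ideal of S containing an idempotent e, and that L ∩ L(x) ≠ ∅ for every x ∈ L. Then e is a right identity for L (x•e = x for all x ∈ L), the set X of idempotents of L is a partial left zero semigroup (x•y = x whenever x, y ∈ X and y ∈ R(x)), G := e•L = {e•x : x ∈ L ∩ R(e)} is a partial group, and the map ψ : (x,g) ↦ x•g, defined on D = {(x,g) ∈ X × G : x•g is defined}, is a bijection from D onto L which is a partial homomorphism: whenever (x₁,g₁), (x₂,g₂) ∈ D and ψ(x₁,g₁)•ψ(x₂,g₂) is defined, x₁•x₂ and g₁•g₂ are defined, (x₁•x₂, g₁•g₂) ∈ D, and ψ(x₁,g₁)•ψ(x₂,g₂) = ψ(x₁•x₂, g₁•g₂). In particular L = X•G and X × G are partially isomorphic. -/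

import Mathlib

/-- A partial semigroup: `op x y = some z` means `x • y` is defined and equals `z`. -/
def StrongAssoc {S : Type*} (op : S → S → Option S) : Prop :=
  ∀ x y z : S, (op x y).bind (fun w => op w z) = (op y z).bind (fun w => op x w)

def IsLeftIdeal {S : Type*} (op : S → S → Option S) (I : Set S) : Prop :=
  I.Nonempty ∧ ∀ x ∈ I, ∀ y z : S, op y x = some z → z ∈ I

def IsMinimalLeftIdeal {S : Type*} (op : S → S → Option S) (L : Set S) : Prop :=
  IsLeftIdeal op L ∧ ∀ J : Set S, IsLeftIdeal op J → J ⊆ L → J = L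

/-- A subset `G` is a partial group (with the induced operation): it is closed under the
partial operation and has a left identity `e` such that every `x ∈ G` has a left
`e`-inverse in `G`. -/
def IsPartialGroupOn {S : Type*} (op : S → S → Option S) (G : Set S) : Prop :=
  (∀ x ∈ G, ∀ y ∈ G, ∀ w, op x y = some w → w ∈ G) ∧
  ∃ e ∈ G, (∀ x ∈ G, op e x = some x) ∧ ∀ x ∈ G, ∃ y ∈ G, op y x = some e

/-- The idempotents of `L`. -/
def IdemIn {S : Type*} (op : S → S → Option S) (L : Set S) : Set S :=
  {x | x ∈ L ∧ op x x = some x}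

/-- `G = e•L = {e•x : x ∈ L ∩ R(e)}`. -/
def eL {S : Type*} (op : S → S → Option S) (e : S) (L : Set S) : Set S :=
  {w | ∃ x ∈ L, op e x = some w}

theorem sa_right {S : Type*} {op : S → S → Option S} (h : StrongAssoc op) {x y z a b : S}
    (h1 : op x y = some a) (h2 : op a z = some b) : ∃ c, op y z = some c ∧ op x c = some b := by
  have := h x y z
  rw [h1, Option.bind_some, h2] at this
  exact Option.bind_eq_some_iff.1 this.symm

theorem sa_left {S : Type*} {op : S → S → Option S} (h : StrongAssoc op) {x y z a b : S}
    (h1 : op y z = some a) (h2 : op x a = some b) : ∃ c, op x y = some c ∧ op c z = some b := by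
  have := h x y z
  rw [h1, Option.bind_some, h2] at this
  exact Option.bind_eq_some_iff.1 this

theorem sa_eq {S : Type*} {op : S → S → Option S} (h : StrongAssoc op) {x y z a b : S}
    (h1 : op x y = some a) (h2 : op y z = some b) : op a z = op x b := by
  have := h x y z
  rwa [h1, h2, Option.bind_some, Option.bind_some] at this

/-- if `L` is a minimal left ideal containing an idempotent `e`, and
`L ∩ L(x) ≠ ∅` for every `x ∈ L`, then `e` is a right identity for `L`, the idempotents
`X` of `L` form a partial left zero semigroup, `G = e•L` is a partial group, and
`ψ : (x,g) ↦ x•g` is a bijection from `D = {(x,g) ∈ X × G : x•g defined}` onto `L`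
which is a partial homomorphism; in particular `L = X•G` and `X × G` are partially
isomorphic. -/
theorem stmt_9 {S : Type*} (op : S → S → Option S) (hassoc : StrongAssoc op)
    (L : Set S) (hL : IsMinimalLeftIdeal op L)
    (e : S) (heL : e ∈ L) (he : op e e = some e)
    (hLL : ∀ x ∈ L, ∃ s ∈ L, (op s x).isSome) :
    (∀ x ∈ L, op x e = some x) ∧
    (∀ x ∈ IdemIn op L, ∀ y ∈ IdemIn op L, (op x y).isSome → op x y = some x) ∧
    IsPartialGroupOn op (eL op e L) ∧
    (∀ x ∈ IdemIn op L, ∀ g ∈ eL op e L, ∀ w, op x g = some w → w ∈ L) ∧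
    (∀ s ∈ L, ∃! p : S × S,
      p.1 ∈ IdemIn op L ∧ p.2 ∈ eL op e L ∧ op p.1 p.2 = some s) ∧
    (∀ x₁ g₁ x₂ g₂ s₁ s₂ w : S,
      x₁ ∈ IdemIn op L → g₁ ∈ eL op e L → op x₁ g₁ = some s₁ →
      x₂ ∈ IdemIn op L → g₂ ∈ eL op e L → op x₂ g₂ = some s₂ →
      op s₁ s₂ = some w →
      ∃ x₃ g₃ : S, op x₁ x₂ = some x₃ ∧ op g₁ g₂ = some g₃ ∧
        x₃ ∈ IdemIn op L ∧ g₃ ∈ eL op e L ∧ op x₃ g₃ = some w) := by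
  have hid := hL.1.2
  have hright : ∀ f ∈ IdemIn op L, ∀ x ∈ L, op x f = some x := by
    rintro f ⟨hfL, hf⟩ x hx
    have hJ : {z | ∃ s, op s f = some z} = L := by
      apply hL.2
      · refine ⟨⟨f, f, hf⟩, ?_⟩
        rintro a ⟨s, hs⟩ y z hz
        obtain ⟨c, -, hc⟩ := sa_left hassoc hs hz
        exact ⟨c, hc⟩
      · rintro z ⟨s, hs⟩
        exact hid f hfL s z hs
    rw [← hJ] at hx
    obtain ⟨s, hs⟩ := hx
    rw [sa_eq hassoc hs hf, hs]
  have heX : e ∈ IdemIn op L := ⟨heL, he⟩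
  have hre := hright e heX
  have hinv : ∀ s ∈ L, ∃ t ∈ L, op t s = some e := by
    intro s hs
    have hJ : {z | ∃ t ∈ L, op t s = some z} = L := by
      apply hL.2
      · refine ⟨?_, ?_⟩
        · obtain ⟨t, ht, h⟩ := hLL s hs
          obtain ⟨z, hz⟩ := Option.isSome_iff_exists.1 h
          exact ⟨z, t, ht, hz⟩
        · rintro a ⟨t, htL, ht⟩ y z hz
          obtain ⟨c, hc1, hc⟩ := sa_left hassoc ht hz
          exact ⟨c, hid t htL y c hc1, hc⟩
      · rintro z ⟨t, -, ht⟩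
        exact hid s hs t z ht
    rw [← hJ] at heL
    exact heL
  have hGL : ∀ g ∈ eL op e L, g ∈ L := by
    rintro g ⟨x, hx, h⟩
    exact hid x hx e g h
  have hGe : ∀ g ∈ eL op e L, op e g = some g := by
    rintro g ⟨x, hx, h⟩
    rw [← sa_eq hassoc he h, h]
  have hGinv : ∀ s ∈ L, ∃ t ∈ eL op e L, op t s = some e := by
    intro s hs
    obtain ⟨t, htL, ht⟩ := hinv s hs
    obtain ⟨c, hc1, hc⟩ := sa_left hassoc ht he
    exact ⟨c, ⟨t, htL, hc1⟩, hc⟩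
  have hGmul : ∀ x ∈ eL op e L, ∀ y ∈ eL op e L, ∀ w, op x y = some w → w ∈ eL op e L := by
    intro x hx y hy w hw
    refine ⟨w, hid y (hGL y hy) x w hw, ?_⟩
    rw [← sa_eq hassoc (hGe x hx) hw, hw]
  refine ⟨hre, ?_, ⟨hGmul, e, ⟨e, heL, he⟩, hGe, fun x hx => hGinv x (hGL x hx)⟩, ?_, ?_, ?_⟩
  · intro x hx y hy _
    exact hright y hy x hx.1
  · intro x hx g hg w hw
    exact hid g (hGL g hg) x w hw
  · intro s hs
    obtain ⟨t, htG, hts⟩ := hGinv s hs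
    have htL := hGL t htG
    obtain ⟨h, hhG, hht⟩ := hGinv t htL
    -- h = e • s
    have hes : op e s = some h := by
      rw [sa_eq hassoc hht hts, hre h (hGL h hhG)]
    -- h • t = e, s • t = x
    obtain ⟨x, hst, hxs⟩ := sa_left hassoc hts (hre s hs)
    have hxL : x ∈ L := hid t htL s x hst
    have hxx : op x x = some x := by
      rw [← sa_eq hassoc hxs hst, hst]
    refine ⟨(x, h), ⟨⟨hxL, hxx⟩, hhG, ?_⟩, ?_⟩
    · change op x h = some s
      rw [← sa_eq hassoc (hre x hxL) hes, hxs]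
    · rintro ⟨y, g⟩ ⟨hy, hg, hyg⟩
      change op y g = some s at hyg
      have hey : op e y = some e := hright y hy e heL
      have hgh : g = h := by
        have := sa_eq hassoc hey hyg
        rw [hes, hGe g hg] at this
        exact Option.some.inj this
      subst hgh
      have h2 := sa_eq hassoc hyg hht
      rw [hst, hre y hy.1] at h2
      rw [Option.some.inj h2]
  · intro x₁ g₁ x₂ g₂ s₁ s₂ w hx₁ hg₁ h₁ hx₂ hg₂ h₂ hw
    have hs₁ : s₁ ∈ L := hid g₁ (hGL g₁ hg₁) x₁ s₁ h₁
    have h3 : op s₁ g₂ = some w := by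
      rw [sa_eq hassoc (hright x₂ hx₂ s₁ hs₁) h₂, hw]
    obtain ⟨g₃, hg, hxg⟩ := sa_right hassoc h₁ h3
    exact ⟨x₁, g₃, hright x₂ hx₂ x₁ hx₁.1, hg, hx₁, hGmul g₁ hg₁ g₂ hg₂ g₃ hg, hxg⟩
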